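/- arXiv:1904.11807 — 5 statements merged into one kernel-verified Lean document; each statement's English description precedes it below -/
import Mathlib

section
/- Let Q be a finite nonempty set and μ, μ' two distinct probability distributions on Q. Define p: Q → [0,1] by p(c) = 0 if μ(c) ≤ μ'(c) and p(c) = (μ(c) − μ'(c))/μ(c) otherwise, and define the probability distribution ν on Q by ν(b) = max{0, μ'(b) − μ(b)} / Σ_{x∈Q} max{0, μ(x) − μ'(x)}. Then for every x ∈ Q, μ(x)·(1 − p(x)) + ν(x)·Σ_{y∈Q} μ(y)·p(y) = μ'(x). Equivalently, if a is sampled from μ and then, independently with probability p(a), a is replaced by a fresh independent sample b from ν, the resulting output is distributed exactly according to μ'. -/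
/-- The resampling (correction) step transforms a sample of `μ` into an exact
sample of `μ'`: with `p(c) = 0` if `μ(c) ≤ μ'(c)` and `p(c) = (μ(c) − μ'(c))/μ(c)` otherwise,
and `ν(b) = max{0, μ'(b) − μ(b)} / Σ_x max{0, μ(x) − μ'(x)}`, for every `x ∈ Q`,
`μ(x)·(1 − p(x)) + ν(x)·Σ_y μ(y)·p(y) = μ'(x)`. -/
theorem resampling_step_produces_target_distribution
    {Q : Type*} [Fintype Q] [Nonempty Q]
    (μ μ' : Q → ℝ)
    (hμ0 : ∀ x, 0 ≤ μ x) (hμ1 : ∑ x, μ x = 1)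
    (hμ'0 : ∀ x, 0 ≤ μ' x) (hμ'1 : ∑ x, μ' x = 1)
    (hne : μ ≠ μ')
    (p : Q → ℝ)
    (hp : ∀ c, p c = if μ c ≤ μ' c then 0 else (μ c - μ' c) / μ c)
    (ν : Q → ℝ)
    (hν : ∀ b, ν b = max 0 (μ' b - μ b) / ∑ x, max 0 (μ x - μ' x)) :
    ∀ x, μ x * (1 - p x) + ν x * ∑ y, μ y * p y = μ' x := by
  have hmul : ∀ y, μ y * p y = max 0 (μ y - μ' y) := by
    intro y
    rw [hp]
    split_ifs with h
    · rw [mul_zero, max_eq_left (sub_nonpos.2 h)]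
    · have hlt := not_le.1 h
      rw [mul_div_cancel₀ _ ((hμ'0 y).trans_lt hlt).ne', max_eq_right (sub_pos.2 hlt).le]
  have hsum : ∑ y, max 0 (μ y - μ' y) ≠ 0 := by
    intro h
    rw [Finset.sum_eq_zero_iff_of_nonneg fun _ _ => le_max_left _ _] at h
    have hle : ∀ y ∈ Finset.univ, μ y ≤ μ' y := fun y hy =>
      sub_nonpos.1 ((le_max_right _ _).trans (h y hy).le)
    exact hne (funext fun y =>
      (Finset.sum_eq_sum_iff_of_le hle).1 (hμ1.trans hμ'1.symm) y (Finset.mem_univ y))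
  intro x
  rw [mul_sub, mul_one, hmul, hν, Finset.sum_congr rfl fun y _ => hmul y,
    div_mul_cancel₀ _ hsum]
  rcases le_total (μ x) (μ' x) with h | h
  · rw [max_eq_left (sub_nonpos.2 h), max_eq_right (sub_nonneg.2 h)]
    ring
  · rw [max_eq_right (sub_nonneg.2 h), max_eq_left (sub_nonpos.2 h)]
    ring
end

section
/- Let Q be a finite nonempty set, D ≥ 0 a real number, and f, g: Q → ℝ functions with |f(a) − g(a)| ≤ D for all a ∈ Q. Define the probability distributions μ_f(c) = e^{f(c)} / Σ_{a∈Q} e^{f(a)} and μ_g(c) = e^{g(c)} / Σ_{a∈Q} e^{g(a)}. Then for every c ∈ Q, μ_f(c) − μ_g(c) ≤ (1 − e^{−2D})·μ_f(c) ≤ 2D·μ_f(c). -/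
/-- If `|f(a) − g(a)| ≤ D` for all `a`, then the softmax (Gibbs) distributions
`μ_f(c) = e^{f(c)}/Σ_a e^{f(a)}` and `μ_g(c) = e^{g(c)}/Σ_a e^{g(a)}` satisfy, for every `c`,
`μ_f(c) − μ_g(c) ≤ (1 − e^{−2D})·μ_f(c) ≤ 2D·μ_f(c)`. -/
theorem softmax_lipschitz_bound
    {Q : Type*} [Fintype Q] [Nonempty Q]
    (D : ℝ) (hD : 0 ≤ D)
    (f g : Q → ℝ) (h : ∀ a, |f a - g a| ≤ D) :
    ∀ c : Q,
      Real.exp (f c) / (∑ a, Real.exp (f a)) - Real.exp (g c) / (∑ a, Real.exp (g a))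
          ≤ (1 - Real.exp (-(2 * D))) * (Real.exp (f c) / ∑ a, Real.exp (f a)) ∧
      (1 - Real.exp (-(2 * D))) * (Real.exp (f c) / ∑ a, Real.exp (f a))
          ≤ 2 * D * (Real.exp (f c) / ∑ a, Real.exp (f a)) := by
  intro c
  have hf : 0 < ∑ a, Real.exp (f a) := Finset.sum_pos (fun a _ => Real.exp_pos _) Finset.univ_nonempty
  have hg : 0 < ∑ a, Real.exp (g a) := Finset.sum_pos (fun a _ => Real.exp_pos _) Finset.univ_nonempty
  have hsum : Real.exp (-D) * ∑ a, Real.exp (g a) ≤ ∑ a, Real.exp (f a) := by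
    rw [Finset.mul_sum]
    refine Finset.sum_le_sum fun a _ => ?_
    rw [← Real.exp_add, Real.exp_le_exp]
    linarith [(abs_le.mp (h a)).1]
  have hc : Real.exp (-D) * Real.exp (f c) ≤ Real.exp (g c) := by
    rw [← Real.exp_add, Real.exp_le_exp]
    linarith [(abs_le.mp (h c)).2]
  have hexp : Real.exp (-(2 * D)) = Real.exp (-D) * Real.exp (-D) := by
    rw [← Real.exp_add]
    ring_nf
  have key : Real.exp (-(2 * D)) * (Real.exp (f c) / ∑ a, Real.exp (f a)) ≤
      Real.exp (g c) / ∑ a, Real.exp (g a) := by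
    rw [← mul_div_assoc, div_le_div_iff₀ hf hg, hexp]
    calc _ = (Real.exp (-D) * Real.exp (f c)) * (Real.exp (-D) * ∑ a, Real.exp (g a)) := by ring
      _ ≤ _ := by gcongr
  refine ⟨by linarith, mul_le_mul_of_nonneg_right ?_ (by positivity)⟩
  linarith [Real.add_one_le_exp (-(2 * D))]
end

section
/- Let I = (V,E,Q,Φ) and I' = (V,E,Q,Φ') be two MRF instances on the same finite graph G = (V,E) with the same finite domain Q and real-valued potentials Φ = (φ_a)_{a∈V∪E}, Φ' = (φ'_a)_{a∈V∪E}. Fix v ∈ V and τ ∈ Q^{Γ(v)}. Then for every c ∈ Q, μ_{v,I}(c|τ) − μ_{v,I'}(c|τ) ≤ 2·μ_{v,I}(c|τ)·( ‖φ_v − φ'_v‖_1 + Σ_{e={u,v}∈E} ‖φ_e − φ'_e‖_1 ), where ‖φ_v − φ'_v‖_1 = Σ_{c∈Q} |φ_v(c) − φ'_v(c)| and ‖φ_e − φ'_e‖_1 = Σ_{c,c'∈Q} |φ_e(c,c') − φ'_e(c,c')|. Consequently the resampling probability p^τ_{I_v,I'_v}(c), defined as 0 when μ_{v,I}(c|τ)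 ≤ μ_{v,I'}(c|τ) and as (μ_{v,I}(c|τ) − μ_{v,I'}(c|τ))/μ_{v,I}(c|τ) otherwise, satisfies p^τ_{I_v,I'_v}(c) ≤ 2( ‖φ_v − φ'_v‖_1 + Σ_{e={u,v}∈E} ‖φ_e − φ'_e‖_1 ). -/
open Finset

/-- If two potentials differ by at most `B` pointwise, then the corresponding Gibbs weights differ
by a factor of at least `1 - 2 * B`. -/
lemma gibbs_weight_mul_one_sub_le {Q : Type*} [Fintype Q] {f g : Q → ℝ} {B : ℝ}
    (h : ∀ a, |f a - g a| ≤ B) (c : Q) :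
    Real.exp (f c) / (∑ a, Real.exp (f a)) * (1 - 2 * B) ≤
      Real.exp (g c) / ∑ a, Real.exp (g a) := by
  have hpos (k : Q → ℝ) : 0 < ∑ a, Real.exp (k a) :=
    sum_pos (fun a _ => Real.exp_pos _) ⟨c, mem_univ c⟩
  have hsum : ∑ a, Real.exp (g a) ≤ Real.exp B * ∑ a, Real.exp (f a) := by
    rw [mul_sum]
    refine sum_le_sum fun a _ => ?_
    rw [← Real.exp_add]
    exact Real.exp_le_exp.2 (by linarith [(abs_le.1 (h a)).1])
  have hexp : 1 - 2 * B ≤ Real.exp (-(2 * B)) := by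
    linarith [Real.add_one_le_exp (-(2 * B))]
  have hpt : Real.exp (f c) * Real.exp (-(2 * B)) * Real.exp B ≤ Real.exp (g c) := by
    rw [← Real.exp_add, ← Real.exp_add]
    exact Real.exp_le_exp.2 (by linarith [(abs_le.1 (h c)).2])
  rw [div_mul_eq_mul_div, div_le_div_iff₀ (hpos f) (hpos g)]
  calc Real.exp (f c) * (1 - 2 * B) * ∑ a, Real.exp (g a)
      ≤ Real.exp (f c) * Real.exp (-(2 * B)) * ∑ a, Real.exp (g a) :=
        mul_le_mul_of_nonneg_right (mul_le_mul_of_nonneg_left hexp (Real.exp_pos _).le)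
          (hpos g).le
    _ ≤ Real.exp (f c) * Real.exp (-(2 * B)) * (Real.exp B * ∑ a, Real.exp (f a)) :=
        mul_le_mul_of_nonneg_left hsum (by positivity)
    _ = Real.exp (f c) * Real.exp (-(2 * B)) * Real.exp B * ∑ a, Real.exp (f a) := by ring
    _ ≤ Real.exp (g c) * ∑ a, Real.exp (f a) :=
        mul_le_mul_of_nonneg_right hpt (hpos f).le

/-- For two MRF instances `I = (V,E,Q,Φ)` and `I' = (V,E,Q,Φ')` on the same graph
with real-valued potentials, for any vertex `v` and boundary configuration `τ`, the conditional
marginals satisfy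
`μ_{v,I}(c|τ) − μ_{v,I'}(c|τ) ≤ 2·μ_{v,I}(c|τ)·(‖φ_v − φ'_v‖₁ + Σ_{e∋v} ‖φ_e − φ'_e‖₁)`,
and consequently the resampling probability `p^τ(c)` is at most
`2(‖φ_v − φ'_v‖₁ + Σ_{e∋v} ‖φ_e − φ'_e‖₁)`. -/
theorem marginal_difference_bound_and_resampling_probability_bound
    {V Q : Type*} [Fintype V] [Fintype Q] [Nonempty Q]
    (G : SimpleGraph V) [DecidableRel G.Adj]
    (φ φ' : V → Q → ℝ) (ψ ψ' : V → V → Q → Q → ℝ)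
    (hψsym : ∀ u v c c', ψ u v c c' = ψ v u c' c)
    (hψ'sym : ∀ u v c c', ψ' u v c c' = ψ' v u c' c)
    (hQ2 : 2 ≤ Fintype.card Q)
    (v : V) (τ : V → Q) :
    let μ : Q → ℝ := fun c =>
      Real.exp (φ v c + ∑ u ∈ G.neighborFinset v, ψ u v (τ u) c) /
        ∑ a, Real.exp (φ v a + ∑ u ∈ G.neighborFinset v, ψ u v (τ u) a)
    let μ' : Q → ℝ := fun c =>
      Real.exp (φ' v c + ∑ u ∈ G.neighborFinset v, ψ' u v (τ u) c) /
        ∑ a, Real.exp (φ' v a + ∑ u ∈ G.neighborFinset v, ψ' u v (τ u) a)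
    let B : ℝ := (∑ c, |φ v c - φ' v c|) +
      ∑ u ∈ G.neighborFinset v, ∑ c, ∑ c', |ψ u v c c' - ψ' u v c c'|
    ∀ c : Q,
      μ c - μ' c ≤ 2 * μ c * B ∧
      (if μ c ≤ μ' c then (0 : ℝ) else (μ c - μ' c) / μ c) ≤ 2 * B := by
  intro μ μ' B c
  have hB : ∀ a, |(φ v a + ∑ u ∈ G.neighborFinset v, ψ u v (τ u) a) -
      (φ' v a + ∑ u ∈ G.neighborFinset v, ψ' u v (τ u) a)| ≤ B := by
    intro a
    rw [add_sub_add_comm, ← sum_sub_distrib]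
    refine (abs_add_le _ _).trans (add_le_add ?_ ?_)
    · exact single_le_sum (f := fun c => |φ v c - φ' v c|) (fun _ _ => abs_nonneg _) (mem_univ a)
    · refine (abs_sum_le_sum_abs _ _).trans (sum_le_sum fun u _ => ?_)
      exact (single_le_sum (f := fun c' => |ψ u v (τ u) c' - ψ' u v (τ u) c'|)
        (fun _ _ => abs_nonneg _) (mem_univ a)).trans
        (single_le_sum (f := fun c => ∑ c', |ψ u v c c' - ψ' u v c c'|)
          (fun _ _ => sum_nonneg fun _ _ => abs_nonneg _) (mem_univ (τ u)))
  have hB0 : 0 ≤ B := (abs_nonneg _).trans (hB c)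
  have hμ : 0 < μ c := div_pos (Real.exp_pos _)
    (sum_pos (fun a _ => Real.exp_pos _) ⟨c, mem_univ c⟩)
  have hmain : μ c * (1 - 2 * B) ≤ μ' c := gibbs_weight_mul_one_sub_le hB c
  have hdiff : μ c - μ' c ≤ 2 * μ c * B := by linarith
  refine ⟨hdiff, ?_⟩
  split_ifs
  · linarith
  · rw [div_le_iff₀ hμ]
    linarith
end

section
/- Let I = (V,E,Q,Φ) be an MRF instance with n = |V| that satisfies the Dobrushin–Shlosman condition with constant δ > 0. Then every one-step optimal coupling (X_t,Y_t)_{t≥0} of the Gibbs sampling chain on I satisfies, for all σ, τ ∈ Q^V and all t ≥ 1, E[H(X_t,Y_t) | X_{t−1} = σ ∧ Y_{t−1} = τ] ≤ (1 − δ/n)·H(σ,τ), where H(σ,τ) = |{v ∈ V : σ_v ≠ τ_v}| is the Hamming distance. -/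
open Finset
open scoped ENNReal

/-- Exponential on `ℝ ∪ {−∞}` (modeled as `WithBot ℝ`), with `exp(−∞) = 0`. -/
noncomputable def expB (x : WithBot ℝ) : ℝ := WithBot.recBotCoe 0 Real.exp x

/-- Total variation distance between two distributions on a finite set. -/
noncomputable def tvDist {Q : Type*} [Fintype Q] (μ ν : Q → ℝ) : ℝ :=
  2⁻¹ * ∑ x, |μ x - ν x|

/-- `D` is a coupling of the distributions `μ` and `ν` on a finite set. -/
def IsCoupling {Q : Type*} [Fintype Q] (μ ν : Q → ℝ) (D : Q → Q → ℝ) : Prop :=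
  (∀ c c', 0 ≤ D c c') ∧ (∀ c, ∑ c', D c c' = μ c) ∧ (∀ c', ∑ c, D c c' = ν c')

/-- `D` is an optimal coupling of `μ` and `ν`: a coupling maximizing the probability
of agreement of the two coordinates. -/
def IsOptimalCoupling {Q : Type*} [Fintype Q] (μ ν : Q → ℝ) (D : Q → Q → ℝ) : Prop :=
  IsCoupling μ ν D ∧
    ∀ D' : Q → Q → ℝ, IsCoupling μ ν D' → ∑ c, D' c c ≤ ∑ c, D c c

/-- Distribution of a finite-state Markov chain with transition kernel `P` after `t` steps,
started from the initial distribution `init`. -/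
noncomputable def chainDist {S : Type*} [Fintype S] (P : S → S → ℝ) (init : S → ℝ) :
    ℕ → S → ℝ
  | 0 => init
  | t + 1 => fun s' => ∑ s, chainDist P init t s * P s s'

/-- Point mass at `s0`. -/
noncomputable def initDelta {S : Type*} [DecidableEq S] (s0 : S) : S → ℝ :=
  fun s => if s = s0 then 1 else 0

/-- Transition kernel of a coupled pair of single-site (Gibbs-sampling style) chains:
a uniformly random vertex `v` is picked, all other coordinates of both copies are copied,
and the pair of new values at `v` is drawn from the local coupling `Dloc v`. -/
noncomputable def pairKernel {V Q : Type*} [Fintype V] [Fintype Q]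
    (Dloc : V → (V → Q) → (V → Q) → Q → Q → ℝ)
    (p p' : (V → Q) × (V → Q)) : ℝ := by
  classical
  exact (Fintype.card V : ℝ)⁻¹ * ∑ v,
    (if (∀ u, u ≠ v → p'.1 u = p.1 u) ∧ (∀ u, u ≠ v → p'.2 u = p.2 u)
      then Dloc v p.1 p.2 (p'.1 v) (p'.2 v) else 0)

/-- The resampling probability `p(c)` used in the local coupling for Hamiltonian update. -/
noncomputable def pResample {Q : Type*} (μ μ' : Q → ℝ) (c : Q) : ℝ := by
  classical
  exact if μ c ≤ μ' c then 0 else (μ c - μ' c) / μ c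

/-- The resampling distribution `ν` used in the local coupling for Hamiltonian update. -/
noncomputable def nuResample {Q : Type*} [Fintype Q] (μ μ' : Q → ℝ) (b : Q) : ℝ :=
  max 0 (μ' b - μ b) / ∑ x, max 0 (μ x - μ' x)

/-- The joint law of the local coupling for Hamiltonian update: first `(c,c')` is drawn from
the optimal coupling `Dopt`, then with probability `pResample μ μ' c'` the second coordinate
is resampled from `nuResample μ μ'`. -/
noncomputable def hamCoupling {Q : Type*} [Fintype Q] (μ μ' : Q → ℝ)
    (Dopt : Q → Q → ℝ) (c d : Q) : ℝ :=
  Dopt c d * (1 - pResample μ μ' d) +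
    nuResample μ μ' d * ∑ c', Dopt c c' * pResample μ μ' c'

/-- Indicator (as a real number) of the event `v ∈ Γ⁺(D)`, where `D` is the set of
disagreements between the two coordinates of the pair state `p`. -/
noncomputable def indNbr {V Q : Type*} [Fintype V] (G : SimpleGraph V)
    (p : (V → Q) × (V → Q)) (v : V) : ℝ := by
  classical
  exact if (∃ u, (u = v ∨ G.Adj v u) ∧ p.1 u ≠ p.2 u) then 1 else 0

/-- `v` is incident to an edge of the symmetric difference of the edge sets of `G` and `G'`. -/
def inS {V : Type*} (G G' : SimpleGraph V) (v : V) : Prop :=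
  ∃ u, (G.Adj v u ∧ ¬ G'.Adj v u) ∨ (G'.Adj v u ∧ ¬ G.Adj v u)

/-- Indicator (as a real number) of the event `v ∈ S ∪ Γ_G⁺(D)`. -/
noncomputable def indSnbr {V Q : Type*} [Fintype V] (G G' : SimpleGraph V)
    (p : (V → Q) × (V → Q)) (v : V) : ℝ := by
  classical
  exact if inS G G' v ∨ (∃ u, (u = v ∨ G.Adj v u) ∧ p.1 u ≠ p.2 u) then 1 else 0

/-- Conditional marginal distribution `μ_{v,I}(·|τ)` of the MRF at vertex `v` given the
configuration `τ` on its neighborhood, where the MRF on the graph `G` has vertex potentials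
`φ` and (symmetric) edge potentials `ψ` with values in `ℝ ∪ {−∞}`. -/
noncomputable def margW {V Q : Type*} [Fintype V] [Fintype Q]
    (G : SimpleGraph V) [DecidableRel G.Adj]
    (φ : V → Q → WithBot ℝ) (ψ : V → V → Q → Q → WithBot ℝ)
    (v : V) (τ : V → Q) (c : Q) : ℝ :=
  expB (φ v c + ∑ u ∈ G.neighborFinset v, ψ u v (τ u) c) /
    ∑ a, expB (φ v a + ∑ u ∈ G.neighborFinset v, ψ u v (τ u) a)

/-- The influence matrix `A_I(u,v)`: the largest total variation distance between the
conditional marginals at `v` induced by two boundary configurations differing only at `u`,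
when `{u,v}` is an edge, and `0` otherwise. -/
noncomputable def influence {V Q : Type*} [Fintype V] [Fintype Q]
    (G : SimpleGraph V) [DecidableRel G.Adj]
    (φ : V → Q → WithBot ℝ) (ψ : V → V → Q → Q → WithBot ℝ) (u v : V) : ℝ := by
  classical
  exact if G.Adj u v then
      sSup {d : ℝ | ∃ σ τ : V → Q, (∀ w, w ≠ u → σ w = τ w) ∧
        d = tvDist (margW G φ ψ v σ) (margW G φ ψ v τ)}
    else 0

/-- The Dobrushin–Shlosman condition with constant `δ`. -/
def DobrushinCondition {V Q : Type*} [Fintype V] [Fintype Q]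
    (G : SimpleGraph V) [DecidableRel G.Adj]
    (φ : V → Q → WithBot ℝ) (ψ : V → V → Q → Q → WithBot ℝ) (δ : ℝ) : Prop :=
  ∀ u : V, ∑ v, influence G φ ψ u v ≤ 1 - δ

/-- The transition kernel of the Gibbs sampling (Glauber dynamics) chain on the MRF:
a uniformly random vertex is picked and its spin resampled from the conditional marginal. -/
noncomputable def gibbsStep {V Q : Type*} [Fintype V] [Fintype Q]
    (G : SimpleGraph V) [DecidableRel G.Adj]
    (φ : V → Q → WithBot ℝ) (ψ : V → V → Q → Q → WithBot ℝ)
    (σ σ' : V → Q) : ℝ := by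
  classical
  exact (Fintype.card V : ℝ)⁻¹ *
    ∑ v, (if ∀ u, u ≠ v → σ' u = σ u then margW G φ ψ v σ (σ' v) else 0)

/-- Unnormalized Gibbs weight `exp(H(σ))` of a configuration. -/
noncomputable def gibbsWeight {V Q : Type*} [Fintype V] [DecidableEq V] [Fintype Q]
    (G : SimpleGraph V) [DecidableRel G.Adj] [Fintype G.edgeSet]
    (φ : V → Q → WithBot ℝ) (ψ : V → V → Q → Q → WithBot ℝ)
    (hψsym : ∀ u v c c', ψ u v c c' = ψ v u c' c) (σ : V → Q) : ℝ :=
  expB ((∑ v, φ v (σ v)) +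
    ∑ e ∈ G.edgeFinset,
      Sym2.lift ⟨fun u w => ψ u w (σ u) (σ w), fun u w => hψsym u w (σ u) (σ w)⟩ e)

/-- The Gibbs distribution `μ_I` of the MRF. -/
noncomputable def gibbsMeasure {V Q : Type*} [Fintype V] [DecidableEq V] [Fintype Q]
    (G : SimpleGraph V) [DecidableRel G.Adj] [Fintype G.edgeSet]
    (φ : V → Q → WithBot ℝ) (ψ : V → V → Q → Q → WithBot ℝ)
    (hψsym : ∀ u v c c', ψ u v c c' = ψ v u c' c) (σ : V → Q) : ℝ :=
  gibbsWeight G φ ψ hψsym σ / ∑ σ' : V → Q, gibbsWeight G φ ψ hψsym σ'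

/-- Distance `|x − y| ∈ [0,∞]` on `ℝ ∪ {−∞}`: `0` if both are `−∞`, `∞` if exactly one is. -/
noncomputable def dB (x y : WithBot ℝ) : ℝ≥0∞ :=
  WithBot.recBotCoe (WithBot.recBotCoe (0 : ℝ≥0∞) (fun _ => (⊤ : ℝ≥0∞)) y)
    (fun r => WithBot.recBotCoe (⊤ : ℝ≥0∞) (fun s => ENNReal.ofReal |r - s|) y) x

/-- The contribution of vertex `v` to the Hamiltonian distance:
`‖φ_v − φ'_v‖₁ + Σ_{e = {u,v} ∈ E} ‖φ_e − φ'_e‖₁`. -/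
noncomputable def dVert {V Q : Type*} [Fintype V] [Fintype Q]
    (G : SimpleGraph V) [DecidableRel G.Adj]
    (φ φ' : V → Q → WithBot ℝ) (ψ ψ' : V → V → Q → Q → WithBot ℝ) (v : V) : ℝ≥0∞ :=
  (∑ c, dB (φ v c) (φ' v c)) +
    ∑ u ∈ G.neighborFinset v, ∑ c, ∑ c', dB (ψ u v c c') (ψ' u v c c')

/-- Hamiltonian distance `d_Ham(I,I') = Σ_v ‖φ_v − φ'_v‖₁ + Σ_{e∈E} ‖φ_e − φ'_e‖₁`
(the edge sum is written as half the sum over ordered adjacent pairs). -/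
noncomputable def dHamiltonian {V Q : Type*} [Fintype V] [Fintype Q]
    (G : SimpleGraph V) [DecidableRel G.Adj]
    (φ φ' : V → Q → WithBot ℝ) (ψ ψ' : V → V → Q → Q → WithBot ℝ) : ℝ≥0∞ :=
  (∑ v, ∑ c, dB (φ v c) (φ' v c)) +
    2⁻¹ * ∑ u, ∑ v ∈ G.neighborFinset u, ∑ c, ∑ c', dB (ψ u v c c') (ψ' u v c c')

/-- The filter probability `p̂_v = min{2(‖φ_v − φ'_v‖₁ + Σ_{e∋v} ‖φ_e − φ'_e‖₁), 1}`. -/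
noncomputable def pHat {V Q : Type*} [Fintype V] [Fintype Q]
    (G : SimpleGraph V) [DecidableRel G.Adj]
    (φ φ' : V → Q → WithBot ℝ) (ψ ψ' : V → V → Q → Q → WithBot ℝ) (v : V) : ℝ :=
  (min (2 * dVert G φ φ' ψ ψ' v) 1).toReal

theorem expB_nonneg (x : WithBot ℝ) : 0 ≤ expB x := by
  induction x using WithBot.recBotCoe with
  | bot => exact le_refl 0
  | coe r => exact (Real.exp_pos r).le

section TotalVariation

variable {Q : Type*} [Fintype Q]

theorem tvDist_self (μ : Q → ℝ) : tvDist μ μ = 0 := by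
  simp [tvDist]

theorem tvDist_triangle (μ ν ρ : Q → ℝ) : tvDist μ ρ ≤ tvDist μ ν + tvDist ν ρ := by
  unfold tvDist
  rw [← mul_add, ← Finset.sum_add_distrib]
  gcongr with x
  exact abs_sub_le _ _ _

/-- Two distributions on a finite set overlap in mass `1 - tvDist μ ν`. -/
theorem sum_min_eq_one_sub_tvDist {μ ν : Q → ℝ} (hμ : ∑ c, μ c = 1) (hν : ∑ c, ν c = 1) :
    ∑ c, min (μ c) (ν c) = 1 - tvDist μ ν := by
  have h : ∀ c, min (μ c) (ν c) = 2⁻¹ * (μ c + ν c) - 2⁻¹ * |μ c - ν c| := fun c => by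
    rcases le_total (μ c) (ν c) with hc | hc
    · rw [min_eq_left hc, abs_of_nonpos (sub_nonpos.2 hc)]
      ring
    · rw [min_eq_right hc, abs_of_nonneg (sub_nonneg.2 hc)]
      ring
  simp only [h, Finset.sum_sub_distrib, ← Finset.mul_sum, Finset.sum_add_distrib, hμ, hν, tvDist]
  norm_num

/-- Some coupling of `μ` and `ν` agrees with probability at least `1 - tvDist μ ν`. -/
theorem exists_isCoupling_one_sub_tvDist_le {μ ν : Q → ℝ} (hμ0 : ∀ c, 0 ≤ μ c)
    (hν0 : ∀ c, 0 ≤ ν c) (hμ : ∑ c, μ c = 1) (hν : ∑ c, ν c = 1) :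
    ∃ D : Q → Q → ℝ, IsCoupling μ ν D ∧ 1 - tvDist μ ν ≤ ∑ c, D c c := by
  classical
  set m : Q → ℝ := fun c => min (μ c) (ν c) with hm
  have hmμ : ∀ c, 0 ≤ μ c - m c := fun c => sub_nonneg.2 (min_le_left _ _)
  have hmν : ∀ c, 0 ≤ ν c - m c := fun c => sub_nonneg.2 (min_le_right _ _)
  have hm0 : ∀ c, 0 ≤ m c := fun c => le_min (hμ0 c) (hν0 c)
  set S : ℝ := 1 - ∑ c, m c with hS
  have hSμ : ∑ c, (μ c - m c) = S := by rw [Finset.sum_sub_distrib, hμ]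
  have hSν : ∑ c, (ν c - m c) = S := by rw [Finset.sum_sub_distrib, hν]
  have hS0 : 0 ≤ S := hSμ ▸ Finset.sum_nonneg fun c _ => hmμ c
  have cancel : ∀ f : Q → ℝ, (∀ c, 0 ≤ f c) → ∑ c, f c = S → ∀ c, f c * S / S = f c := by
    intro f hf hfS c
    rcases eq_or_ne S 0 with h | h
    · have : f c = 0 :=
        (Finset.sum_eq_zero_iff_of_nonneg fun c _ => hf c).1 (hfS.trans h) c (Finset.mem_univ c)
      simp [this]
    · field_simp
  have hres : ∀ c c', 0 ≤ (μ c - m c) * (ν c' - m c') / S := fun c c' =>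
    div_nonneg (mul_nonneg (hmμ c) (hmν c')) hS0
  refine ⟨fun c c' => (if c = c' then m c else 0) + (μ c - m c) * (ν c' - m c') / S,
    ⟨fun c c' => ?_, fun c => ?_, fun c' => ?_⟩, ?_⟩
  · refine add_nonneg ?_ (hres c c')
    split_ifs
    exacts [hm0 c, le_rfl]
  · rw [Finset.sum_add_distrib, ← Finset.sum_div, ← Finset.mul_sum, hSν, cancel _ hmμ hSμ]
    simp
  · rw [Finset.sum_add_distrib, ← Finset.sum_div, ← Finset.sum_mul, hSμ, mul_comm S,
      cancel (fun c => ν c - m c) hmν hSν]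
    simp
  · rw [← sum_min_eq_one_sub_tvDist hμ hν]
    refine Finset.sum_le_sum fun c _ => ?_
    simp only [if_true]
    exact le_add_of_nonneg_right (hres c c)

theorem IsOptimalCoupling.one_sub_sum_diag_le {μ ν : Q → ℝ} {D : Q → Q → ℝ}
    (hD : IsOptimalCoupling μ ν D) (hμ0 : ∀ c, 0 ≤ μ c) (hν0 : ∀ c, 0 ≤ ν c)
    (hμ : ∑ c, μ c = 1) (hν : ∑ c, ν c = 1) : 1 - ∑ c, D c c ≤ tvDist μ ν := by
  obtain ⟨D', hD', hle⟩ := exists_isCoupling_one_sub_tvDist_le hμ0 hν0 hμ hν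
  linarith [hD.2 D' hD']

end TotalVariation

section Marginals

variable {V Q : Type*} [Fintype V] [Fintype Q] (G : SimpleGraph V) [DecidableRel G.Adj]
  (φ : V → Q → WithBot ℝ) (ψ : V → V → Q → Q → WithBot ℝ)

theorem margW_nonneg (v : V) (τ : V → Q) (c : Q) : 0 ≤ margW G φ ψ v τ c :=
  div_nonneg (expB_nonneg _) (Finset.sum_nonneg fun _ _ => expB_nonneg _)

theorem sum_margW {v : V} {τ : V → Q}
    (hpos : 0 < ∑ a, expB (φ v a + ∑ u ∈ G.neighborFinset v, ψ u v (τ u) a)) :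
    ∑ c, margW G φ ψ v τ c = 1 := by
  simp only [margW]
  rw [← Finset.sum_div, div_self hpos.ne']

theorem margW_congr {v : V} {σ τ : V → Q} (h : ∀ u, G.Adj v u → σ u = τ u) :
    margW G φ ψ v σ = margW G φ ψ v τ := by
  have key : ∀ a, ∑ u ∈ G.neighborFinset v, ψ u v (σ u) a =
      ∑ u ∈ G.neighborFinset v, ψ u v (τ u) a := fun a =>
    Finset.sum_congr rfl fun u hu => by rw [h u ((G.mem_neighborFinset v u).1 hu)]
  funext c
  simp only [margW, key]

theorem tvDist_margW_le_influence {u v : V} {σ τ : V → Q} (h : ∀ w, w ≠ u → σ w = τ w) :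
    tvDist (margW G φ ψ v σ) (margW G φ ψ v τ) ≤ influence G φ ψ u v := by
  classical
  unfold influence
  split_ifs with huv
  · refine le_csSup (Set.Finite.bddAbove ?_) ⟨σ, τ, h, rfl⟩
    refine (Set.finite_range fun p : (V → Q) × (V → Q) =>
      tvDist (margW G φ ψ v p.1) (margW G φ ψ v p.2)).subset ?_
    rintro d ⟨σ', τ', -, rfl⟩
    exact ⟨(σ', τ'), rfl⟩
  · rw [margW_congr G φ ψ (σ := σ) (τ := τ), tvDist_self]
    intro w hw
    refine h w ?_
    rintro rfl
    exact huv hw.symm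

/-- Moving from `σ` to `τ` one site at a time bounds the distance between the conditional
marginals at `v` by the total influence on `v` of the sites where `σ` and `τ` disagree. -/
theorem tvDist_margW_le_sum_influence [DecidableEq V] [DecidableEq Q] (v : V) (σ τ : V → Q) :
    tvDist (margW G φ ψ v σ) (margW G φ ψ v τ) ≤
      ∑ u with σ u ≠ τ u, influence G φ ψ u v := by
  have key : ∀ s : Finset V, tvDist (margW G φ ψ v σ) (margW G φ ψ v (s.piecewise τ σ)) ≤
      ∑ u ∈ s, if σ u ≠ τ u then influence G φ ψ u v else 0 := by
    intro s
    induction s using Finset.induction_on with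
    | empty => simp [tvDist_self]
    | insert u s hu ih =>
      rw [Finset.sum_insert hu, Finset.piecewise_insert, add_comm]
      refine (tvDist_triangle _ (margW G φ ψ v (s.piecewise τ σ)) _).trans (add_le_add ih ?_)
      split_ifs with hne
      · refine tvDist_margW_le_influence G φ ψ fun w hw => ?_
        rw [Function.update_of_ne hw]
      · rw [Function.update_eq_self_iff.2, tvDist_self]
        rw [Finset.piecewise_eq_of_notMem _ _ _ hu]
        exact (not_not.1 hne).symm
  simpa [Finset.sum_filter] using key Finset.univ

end Marginals

theorem hammingDist_update_update {V Q : Type*} [Fintype V] [DecidableEq V] [DecidableEq Q]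
    (σ τ : V → Q) (v : V) (c c' : Q) :
    (hammingDist (Function.update σ v c) (Function.update τ v c') : ℝ) =
      hammingDist σ τ - (if σ v ≠ τ v then 1 else 0) + (if c ≠ c' then 1 else 0) := by
  have hsum : ∀ x y : V → Q, (hammingDist x y : ℝ) =
      (if x v ≠ y v then 1 else 0) + ∑ u ∈ Finset.univ.erase v, if x u ≠ y u then 1 else 0 := by
    intro x y
    rw [Finset.add_sum_erase _ (fun u => if x u ≠ y u then (1 : ℝ) else 0) (Finset.mem_univ v),
      Finset.sum_boole]
    rfl
  have hrest : ∑ u ∈ Finset.univ.erase v,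
        (if Function.update σ v c u ≠ Function.update τ v c' u then (1 : ℝ) else 0) =
      ∑ u ∈ Finset.univ.erase v, if σ u ≠ τ u then 1 else 0 :=
    Finset.sum_congr rfl fun u hu => by
      rw [Function.update_of_ne (Finset.ne_of_mem_erase hu),
        Function.update_of_ne (Finset.ne_of_mem_erase hu)]
  rw [hsum (Function.update σ v c), hrest, hsum σ τ, Function.update_self, Function.update_self]
  ring

/-- Expectation of an affine function of the disagreement event under a coupling. -/
theorem IsCoupling.sum_mul_add_ite_ne {Q : Type*} [Fintype Q] [DecidableEq Q] {μ ν : Q → ℝ}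
    {D : Q → Q → ℝ} (hD : IsCoupling μ ν D) (hμ : ∑ c, μ c = 1) (a : ℝ) :
    ∑ c, ∑ c', D c c' * (a + if c ≠ c' then 1 else 0) = a + (1 - ∑ c, D c c) := by
  have hrow : ∀ c, ∑ c', D c c' * (a + if c ≠ c' then 1 else 0) = μ c * (a + 1) - D c c := by
    intro c
    have : ∀ c', D c c' * (a + if c ≠ c' then 1 else 0) =
        D c c' * (a + 1) - if c = c' then D c c' else 0 := fun c' => by
      by_cases h : c = c' <;> simp [h]
      ring
    simp only [this, Finset.sum_sub_distrib, ← Finset.sum_mul, hD.2.1, Finset.sum_ite_eq,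
      Finset.mem_univ, if_true]
  simp only [hrow, Finset.sum_sub_distrib, ← Finset.sum_mul, hμ]
  ring

/-- If the MRF instance `I` satisfies the Dobrushin–Shlosman condition with
constant `δ > 0`, then every one-step optimal coupling of the Gibbs sampling chain on `I`
contracts the expected Hamming distance:
`E[H(X_t,Y_t) | X_{t−1} = σ ∧ Y_{t−1} = τ] ≤ (1 − δ/n)·H(σ,τ)`.
The conditional expectation is written out explicitly: a vertex `v` is picked uniformly at
random and the pair of new spins at `v` is drawn from the optimal coupling `D v σ τ` of the
two conditional marginals. -/
theorem dobrushin_one_step_optimal_coupling_contraction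
    {V Q : Type*} [Fintype V] [DecidableEq V] [Nonempty V]
    [Fintype Q] [DecidableEq Q] [Nonempty Q]
    (G : SimpleGraph V) [DecidableRel G.Adj]
    (φ : V → Q → WithBot ℝ) (ψ : V → V → Q → Q → WithBot ℝ)
    (hψsym : ∀ u v c c', ψ u v c c' = ψ v u c' c)
    (hQ2 : 2 ≤ Fintype.card Q)
    (hpos : ∀ (v : V) (τ : V → Q),
      0 < ∑ a, expB (φ v a + ∑ u ∈ G.neighborFinset v, ψ u v (τ u) a))
    (δ : ℝ) (hδ : 0 < δ)
    (hDob : DobrushinCondition G φ ψ δ)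
    (D : V → (V → Q) → (V → Q) → Q → Q → ℝ)
    (hD : ∀ (v : V) (σ τ : V → Q),
      IsOptimalCoupling (margW G φ ψ v σ) (margW G φ ψ v τ) (D v σ τ)) :
    ∀ σ τ : V → Q,
      (Fintype.card V : ℝ)⁻¹ * ∑ v, ∑ c, ∑ c',
          D v σ τ c c' *
            (hammingDist (Function.update σ v c) (Function.update τ v c') : ℝ)
        ≤ (1 - δ / (Fintype.card V : ℝ)) * (hammingDist σ τ : ℝ) := by
  intro σ τ
  have hn : (0 : ℝ) < Fintype.card V := by exact_mod_cast Fintype.card_pos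
  have hcard : (hammingDist σ τ : ℝ) = ∑ v, if σ v ≠ τ v then (1 : ℝ) else 0 := by
    rw [Finset.sum_boole]
    rfl
  have hlocal : ∀ v, ∑ c, ∑ c', D v σ τ c c' *
        (hammingDist (Function.update σ v c) (Function.update τ v c') : ℝ) ≤
      hammingDist σ τ - (if σ v ≠ τ v then 1 else 0) +
        ∑ u with σ u ≠ τ u, influence G φ ψ u v := by
    intro v
    simp only [hammingDist_update_update]
    rw [(hD v σ τ).1.sum_mul_add_ite_ne (sum_margW G φ ψ (hpos v σ))]
    gcongr
    exact ((hD v σ τ).one_sub_sum_diag_le (margW_nonneg G φ ψ v σ) (margW_nonneg G φ ψ v τ)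
      (sum_margW G φ ψ (hpos v σ)) (sum_margW G φ ψ (hpos v τ))).trans
      (tvDist_margW_le_sum_influence G φ ψ v σ τ)
  have hinf : ∑ v, ∑ u with σ u ≠ τ u, influence G φ ψ u v ≤ hammingDist σ τ * (1 - δ) := by
    rw [Finset.sum_comm]
    refine (Finset.sum_le_card_nsmul _ _ _ fun u _ => hDob u).trans_eq ?_
    rw [nsmul_eq_mul]
    rfl
  have htotal := Finset.sum_le_sum fun v (_ : v ∈ Finset.univ) => hlocal v
  rw [Finset.sum_add_distrib, Finset.sum_sub_distrib, ← hcard, Finset.sum_const,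
    Finset.card_univ, nsmul_eq_mul] at htotal
  calc _ ≤ (Fintype.card V : ℝ)⁻¹ * ((Fintype.card V - δ) * hammingDist σ τ) := by
        gcongr
        linarith
    _ = _ := by
        field_simp
end

section
/- Let ε: ℕ⁺ → (0,1) be a function and C > 0 a constant such that |ε(n+1) − ε(n)| ≤ (C/n)·ε(n) for all n ∈ ℕ⁺. Let l = 3⌈C⌉. Then for every n ≥ l, ε(l) ≤ ε(n)·n^C; in particular ε(n) ≥ ε(l)·n^{−C}, so ε is bounded below by an inverse polynomial in n. -/
/-- The one-step factor `1 - C / x` dominates the ratio of consecutive values of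
`(x - 1 - C) ^ C`. -/
theorem rpow_sub_one_sub_le_one_sub_div_mul_rpow {C x : ℝ} (hC : 0 < C) (hx : 1 + C ≤ x) :
    (x - 1 - C) ^ C ≤ (1 - C / x) * (x - C) ^ C := by
  have hy : 0 < x - C := by linarith
  have hx0 : 0 < x := by linarith
  have hexp : Real.exp (-(C / (x - C))) ≤ 1 - C / x := by
    have hinv : 1 - C / x = (C / (x - C) + 1)⁻¹ := by
      field_simp
      ring
    rw [hinv, Real.exp_neg]
    exact inv_anti₀ (by positivity) (Real.add_one_le_exp _)
  have hbase : x - 1 - C ≤ Real.exp (-(1 / (x - C))) * (x - C) := by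
    have h := mul_le_mul_of_nonneg_right (Real.add_one_le_exp (-(1 / (x - C)))) hy.le
    have hcancel : (-(1 / (x - C)) + 1) * (x - C) = x - 1 - C := by
      field_simp
      ring
    linarith
  calc (x - 1 - C) ^ C ≤ (Real.exp (-(1 / (x - C))) * (x - C)) ^ C :=
        Real.rpow_le_rpow (by linarith) hbase hC.le
    _ = Real.exp (-(C / (x - C))) * (x - C) ^ C := by
        rw [Real.mul_rpow (Real.exp_pos _).le hy.le, ← Real.exp_mul]
        congr 2
        ring
    _ ≤ (1 - C / x) * (x - C) ^ C :=
        mul_le_mul_of_nonneg_right hexp (Real.rpow_nonneg hy.le _)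

/-- If `u (n + 1) ≥ (1 - C / n) * u n` from some index `l ≥ 1 + C` on, then
`u n * (n - 1 - C) ^ C` is nondecreasing from `l` on. -/
theorem mul_rpow_sub_le_mul_rpow_sub {u : ℕ → ℝ} {C : ℝ} {l : ℕ} (hC : 0 < C)
    (hl : 1 + C ≤ l) (hu : ∀ n, l ≤ n → 0 ≤ u n)
    (hstep : ∀ n : ℕ, l ≤ n → (1 - C / n) * u n ≤ u (n + 1)) {n : ℕ} (hn : l ≤ n) :
    u l * ((l : ℝ) - 1 - C) ^ C ≤ u n * ((n : ℝ) - 1 - C) ^ C := by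
  induction n, hn using Nat.le_induction with
  | base => exact le_rfl
  | succ n hn ih =>
    have hln : (l : ℝ) ≤ n := by exact_mod_cast hn
    have hnC : 1 + C ≤ (n : ℝ) := hl.trans hln
    calc u l * ((l : ℝ) - 1 - C) ^ C ≤ u n * ((n : ℝ) - 1 - C) ^ C := ih
      _ ≤ u n * ((1 - C / n) * ((n : ℝ) - C) ^ C) :=
          mul_le_mul_of_nonneg_left (rpow_sub_one_sub_le_one_sub_div_mul_rpow hC hnC) (hu n hn)
      _ = (1 - C / n) * u n * ((n : ℝ) - C) ^ C := by ring
      _ ≤ u (n + 1) * ((n : ℝ) - C) ^ C :=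
          mul_le_mul_of_nonneg_right (hstep n hn) (Real.rpow_nonneg (by linarith) _)
      _ = u (n + 1) * (((n + 1 : ℕ) : ℝ) - 1 - C) ^ C := by
          push_cast
          ring_nf

/-- If `ε: ℕ⁺ → (0,1)` satisfies `|ε(n+1) − ε(n)| ≤ (C/n)·ε(n)` for all `n ≥ 1`,
then with `l = 3⌈C⌉`, for every `n ≥ l` we have `ε(l) ≤ ε(n)·n^C`; in particular
`ε(n) ≥ ε(l)·n^{−C}`, so `ε` is bounded below by an inverse polynomial in `n`. -/
theorem eps_inverse_polynomial_lower_bound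
    (ε : ℕ → ℝ) (C : ℝ) (hC : 0 < C)
    (hrange : ∀ n : ℕ, 1 ≤ n → 0 < ε n ∧ ε n < 1)
    (hbd : ∀ n : ℕ, 1 ≤ n → |ε (n + 1) - ε n| ≤ (C / n) * ε n) :
    ∀ n : ℕ, 3 * ⌈C⌉₊ ≤ n →
      ε (3 * ⌈C⌉₊) ≤ ε n * (n : ℝ) ^ C ∧
      ε (3 * ⌈C⌉₊) * (n : ℝ) ^ (-C) ≤ ε n := by
  intro n hn
  have hceil : 1 ≤ ⌈C⌉₊ := Nat.ceil_pos.mpr hC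
  have hceilR : (1 : ℝ) ≤ ⌈C⌉₊ := by exact_mod_cast hceil
  have hl : C + 2 ≤ ((3 * ⌈C⌉₊ : ℕ) : ℝ) := by
    push_cast
    linarith [Nat.le_ceil C]
  have hnR : ((3 * ⌈C⌉₊ : ℕ) : ℝ) ≤ n := by exact_mod_cast hn
  have hn0 : (0 : ℝ) < n := by linarith
  have hpos : ∀ m, 3 * ⌈C⌉₊ ≤ m → 0 < ε m := fun m hm => (hrange m (by omega)).1
  have hmono := mul_rpow_sub_le_mul_rpow_sub hC (by linarith) (fun m hm => (hpos m hm).le)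
    (fun m hm => by linarith [(abs_le.mp (hbd m (by omega))).1]) hn
  have hmain : ε (3 * ⌈C⌉₊) ≤ ε n * (n : ℝ) ^ C :=
    calc ε (3 * ⌈C⌉₊) ≤ ε (3 * ⌈C⌉₊) * (((3 * ⌈C⌉₊ : ℕ) : ℝ) - 1 - C) ^ C :=
          le_mul_of_one_le_right (hpos _ le_rfl).le
            (Real.one_le_rpow (by linarith) hC.le)
      _ ≤ ε n * ((n : ℝ) - 1 - C) ^ C := hmono
      _ ≤ ε n * (n : ℝ) ^ C :=
          mul_le_mul_of_nonneg_left
            (Real.rpow_le_rpow (by linarith) (by linarith) hC.le) (hpos n hn).le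
  refine ⟨hmain, ?_⟩
  rw [Real.rpow_neg hn0.le, ← div_eq_mul_inv, div_le_iff₀ (Real.rpow_pos_of_pos hn0 C)]
  exact hmain
end
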